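/- Let 0 ≤ α < 1, let f(z) = z·h(z)·conj(g(z)) belong to S*_Lh(α), and set H(z) = z·h(z) for z ∈ 𝔻. Then 1/(2·e^{1−α}) ≤ d(0, ∂(H(𝔻))) ≤ 1. -/

import Mathlib

open Complex Metric

open Set Filter Topology

lemma aux_desc {f : ℝ → ℝ} {f' : ℝ} (hf : HasDerivAt f f' 0) (hneg : f' < 0) :
    ∀ᶠ t in 𝓝[>] (0:ℝ), f t < f 0 := by
  have h1 := hf.tendsto_slope_zero_right
  have h2 := h1.eventually (gt_mem_nhds hneg)
  filter_upwards [h2, self_mem_nhdsWithin] with t ht ht0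
  have ht0' : 0 < t := ht0
  simp only [zero_add, smul_eq_mul] at ht
  by_contra hcon
  push Not at hcon
  have : 0 ≤ t⁻¹ * (f t - f 0) := mul_nonneg (by positivity) (by linarith)
  linarith

lemma aux_log {w : ℝ → ℂ} {w' : ℂ} {t : ℝ} (hw : HasDerivAt w w' t) (h0 : w t ≠ 0) :
    HasDerivAt (fun s => Real.log ‖w s‖) (w' / w t).re t := by
  have hre : HasDerivAt (fun s => (w s).re) w'.re t := by
    simpa using! (Complex.reCLM.hasFDerivAt.comp_hasDerivAt t hw)
  have him : HasDerivAt (fun s => (w s).im) w'.im t := by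
    simpa using! (Complex.imCLM.hasFDerivAt.comp_hasDerivAt t hw)
  have hn : HasDerivAt (fun s => (w s).re * (w s).re + (w s).im * (w s).im) _ t :=
    (hre.mul hre).add (him.mul him)
  have hpos : (w t).re * (w t).re + (w t).im * (w t).im ≠ 0 := by
    have := Complex.normSq_pos.2 h0
    rw [Complex.normSq_apply] at this
    exact this.ne'
  have hl := (hn.log hpos).const_mul (1/2 : ℝ)
  have e : (fun s => Real.log ‖w s‖) =
      fun s => (1/2 : ℝ) * Real.log ((w s).re * (w s).re + (w s).im * (w s).im) := by
    funext s
    rw [← Complex.normSq_apply, Complex.normSq_eq_norm_sq, Real.log_pow]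
    push_cast; ring
  rw [e]
  refine hl.congr_deriv ?_
  symm
  rw [Complex.div_re, Complex.normSq_apply]
  field_simp
  ring

lemma aux_norm {w : ℝ → ℂ} {w' : ℂ} {t : ℝ} (hw : HasDerivAt w w' t) (h0 : w t ≠ 0) :
    HasDerivAt (fun s => ‖w s‖) (‖w t‖ * (w' / w t).re) t := by
  have h1 := (aux_log hw h0).exp
  rw [Real.exp_log (norm_pos_iff.2 h0)] at h1
  refine h1.congr_of_eventuallyEq ?_
  filter_upwards [hw.continuousAt.eventually_ne h0] with s hs
  rw [Real.exp_log (norm_pos_iff.2 hs)]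

lemma aux_q (m : ℂ) (r : ℝ) (hm : ‖m‖ ≤ r) (hr : r < 1) :
    1 / (1 + r) ≤ (1 / (1 - m)).re := by
  have hn0 : 0 ≤ ‖m‖ := norm_nonneg _
  have h1 : 1 / (1 + r) ≤ 1 / (1 + ‖m‖) :=
    one_div_le_one_div_of_le (by linarith) (by linarith)
  refine h1.trans ?_
  have hx := abs_le.1 (Complex.abs_re_le_norm m)
  have hne : 1 - m ≠ 0 := by
    intro h
    have : m = 1 := by linear_combination -h
    rw [this] at hm; simp at hm; linarith
  have hpos := Complex.normSq_pos.2 hne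
  have hsq : ‖m‖ ^ 2 = m.re * m.re + m.im * m.im := by
    rw [← Complex.normSq_apply, Complex.normSq_eq_norm_sq]
  rw [one_div (1 - m), Complex.inv_re, div_le_div_iff₀ (by linarith) hpos]
  rw [Complex.normSq_apply]
  simp only [Complex.sub_re, Complex.one_re, Complex.sub_im, Complex.one_im]
  nlinarith [mul_nonneg (by linarith : 0 ≤ 1 - ‖m‖) (by linarith : 0 ≤ ‖m‖ + m.re)]

lemma aux_alg (x y P c r : ℝ) (hc1 : c ≤ 1) (hc2 : -1 < c) (hr0 : 0 ≤ r) (hr : r < 1)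
    (hP : 0 < P) (hle : x ≤ P) (hsq : P ^ 2 = x * x + y * y)
    (hs : (x - 1) ^ 2 + y ^ 2 ≤ r ^ 2 * ((x + c) ^ 2 + y ^ 2)) :
    1 - c * r ≤ (1 + r) * P := by
  have hrc : 0 < 1 + r ^ 2 * c := by nlinarith [sq_nonneg r]
  have key : ((1 + r) * P - (1 - c * r)) * ((1 - r) * P - (1 + c * r)) ≤ 0 := by
    have k1 := mul_le_mul_of_nonneg_left hle hrc.le
    have k2 : (1 - r ^ 2) * P ^ 2 = (1 - r ^ 2) * (x * x + y * y) := by rw [hsq]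
    linarith
  by_contra hcon
  push Not at hcon
  have a1 : (1 - r) * ((1 + r) * P) ≤ (1 - r) * (1 - c * r) :=
    mul_le_mul_of_nonneg_left hcon.le (by linarith)
  have a2 : (1 - r) * ((1 + r) * P) < (1 - r) * (1 - c * r) :=
    mul_lt_mul_of_pos_left hcon (by linarith)
  have a3 : (1 - r) * (1 - c * r) ≤ (1 + r) * (1 + c * r) := by nlinarith
  have a4 : (1 - r) * P < 1 + c * r := by
    by_contra h3
    push Not at h3
    have := mul_le_mul_of_nonneg_left h3 (by linarith : 0 ≤ 1 + r)
    linarith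
  have := mul_pos_of_neg_of_neg (sub_neg.2 hcon) (sub_neg.2 a4)
  linarith

lemma aux_p (p : ℂ) (α r : ℝ) (h0 : 0 ≤ α) (h1 : α < 1) (hr0 : 0 ≤ r) (hr : r < 1)
    (hre : α < p.re) (hp : ‖p - 1‖ ≤ r * ‖p + (1 - 2 * α : ℝ)‖) :
    0 < (1 / p).re ∧ (1 / p).re * (1 - (1 - 2 * α) * r) ≤ 1 + r := by
  have hp0 : p ≠ 0 := by rintro rfl; simp at hre; linarith
  have hP : 0 < ‖p‖ := norm_pos_iff.2 hp0
  have hns := Complex.normSq_pos.2 hp0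
  have hle : p.re ≤ ‖p‖ := Complex.re_le_norm p
  have hsq : ‖p‖ ^ 2 = p.re * p.re + p.im * p.im := by
    rw [← Complex.normSq_apply, Complex.normSq_eq_norm_sq]
  have e1 : ‖p - 1‖ ^ 2 = (p.re - 1) ^ 2 + p.im ^ 2 := by
    rw [← Complex.normSq_eq_norm_sq, Complex.normSq_apply]; simp; ring
  have e2 : ‖p + (1 - 2 * α : ℝ)‖ ^ 2 = (p.re + (1 - 2 * α)) ^ 2 + p.im ^ 2 := by
    rw [← Complex.normSq_eq_norm_sq, Complex.normSq_apply]
    simp only [Complex.add_re, Complex.add_im, Complex.ofReal_re, Complex.ofReal_im]; ring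
  have hs : ‖p - 1‖ ^ 2 ≤ r ^ 2 * ‖p + (1 - 2 * α : ℝ)‖ ^ 2 := by
    rw [← mul_pow]; exact pow_le_pow_left₀ (norm_nonneg _) hp 2
  rw [e1, e2] at hs
  set c := 1 - 2 * α with hc
  have hc1 : c ≤ 1 := by linarith
  have hc2 : -1 < c := by linarith
  have hcr : 0 < 1 - c * r := by nlinarith
  have hrc : 0 < 1 + r ^ 2 * c := by nlinarith [sq_nonneg r]
  have hlow : 1 - c * r ≤ (1 + r) * ‖p‖ :=
    aux_alg p.re p.im ‖p‖ c r hc1 hc2 hr0 hr hP hle hsq hs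
  rw [one_div, Complex.inv_re]
  refine ⟨div_pos (by linarith) hns, ?_⟩
  rw [Complex.normSq_eq_norm_sq, div_mul_eq_mul_div, div_le_iff₀ (by positivity)]
  calc p.re * (1 - c * r) ≤ ‖p‖ * ((1 + r) * ‖p‖) :=
        mul_le_mul hle hlow hcr.le hP.le
    _ = (1 + r) * ‖p‖ ^ 2 := by ring

lemma aux_dir (α : ℝ) (hα0 : 0 ≤ α) (hα1 : α < 1)
    (h g : ℂ → ℂ)
    (hh : DifferentiableOn ℂ h (ball 0 1))
    (hg : DifferentiableOn ℂ g (ball 0 1))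
    (hhne : ∀ z ∈ ball (0:ℂ) 1, h z ≠ 0)
    (hgne : ∀ z ∈ ball (0:ℂ) 1, g z ≠ 0)
    (hsp : ∀ z ∈ ball (0:ℂ) 1,
      ‖z * deriv g z / g z‖ < ‖1 + z * deriv h z / h z‖)
    (hstar : ∀ z ∈ ball (0:ℂ) 1, z ≠ 0 →
      α < (1 + z * deriv h z / h z - (starRingEnd ℂ) (z * deriv g z / g z)).re)
    (z : ℂ) (hz : z ∈ ball (0:ℂ) 1) (hz0 : z ≠ 0) :
    ∃ v : ℂ, 0 < (v / z).re ∧ (v / z).re * (1 - (1 - 2 * α) * ‖z‖) ≤ 1 + ‖z‖ ∧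
      1 / (1 + ‖z‖) ≤ (v / z).re + (deriv h z * v / h z).re := by
  have hdh : DifferentiableOn ℂ (fun z => z * deriv h z / h z) (ball 0 1) :=
    (differentiableOn_id.mul (hh.deriv isOpen_ball)).div hh hhne
  have hdg : DifferentiableOn ℂ (fun z => z * deriv g z / g z) (ball 0 1) :=
    (differentiableOn_id.mul (hg.deriv isOpen_ball)).div hg hgne
  have hA : ∀ z ∈ ball (0:ℂ) 1, 1 + z * deriv h z / h z ≠ 0 := fun z hz h0 => by
    have := hsp z hz
    rw [h0, norm_zero] at this
    exact absurd this (not_lt.2 (norm_nonneg _))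
  have hzn : ‖z‖ < 1 := by simpa using hz
  have hmu : ‖(z * deriv g z / g z) / (1 + z * deriv h z / h z)‖ ≤ ‖z‖ := by
    refine norm_le_norm_of_mapsTo_ball (R := 1)
      (f := fun z => (z * deriv g z / g z) / (1 + z * deriv h z / h z))
      (hdg.div (hdh.const_add 1) hA) ?_ (by simp) hzn
    intro w hw
    have := hsp w hw
    rw [mem_closedBall_zero_iff, norm_div]
    exact (div_le_one (norm_pos_iff.2 (hA w hw))).2 this.le
  have hre : ∀ w ∈ ball (0:ℂ) 1, α < (1 + w * deriv h w / h w - w * deriv g w / g w).re := by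
    intro w hw
    by_cases hw0 : w = 0
    · subst hw0; simpa using hα1
    · have := hstar w hw hw0
      rwa [Complex.sub_re, Complex.conj_re, ← Complex.sub_re] at this
  have hne : ∀ p : ℂ, α < p.re → p + (1 - 2 * α : ℝ) ≠ 0 := by
    intro p hp h0
    have := congrArg Complex.re h0
    simp only [Complex.add_re, Complex.ofReal_re, Complex.zero_re] at this
    linarith
  have hom : ‖(1 + z * deriv h z / h z - z * deriv g z / g z - 1) /
      (1 + z * deriv h z / h z - z * deriv g z / g z + (1 - 2 * α : ℝ))‖ ≤ ‖z‖ := by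
    have hdp := (hdh.const_add 1).sub hdg
    refine norm_le_norm_of_mapsTo_ball (R := 1)
      (f := fun z => (1 + z * deriv h z / h z - z * deriv g z / g z - 1) /
      (1 + z * deriv h z / h z - z * deriv g z / g z + (1 - 2 * α : ℝ)))
      ((hdp.sub_const 1).div (hdp.add_const _) fun w hw => hne _ (hre w hw)) ?_ (by simp) hzn
    intro w hw
    have hp := hre w hw
    rw [mem_closedBall_zero_iff, norm_div]
    refine (div_le_one (norm_pos_iff.2 (hne _ hp))).2 ?_
    set p := 1 + w * deriv h w / h w - w * deriv g w / g w
    refine le_of_sq_le_sq ?_ (norm_nonneg _)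
    rw [← Complex.normSq_eq_norm_sq, ← Complex.normSq_eq_norm_sq, Complex.normSq_apply,
      Complex.normSq_apply]
    simp only [Complex.add_re, Complex.add_im, Complex.ofReal_re, Complex.ofReal_im,
      Complex.sub_re, Complex.sub_im, Complex.one_re, Complex.one_im]
    nlinarith [mul_pos (sub_pos.2 hp) (sub_pos.2 hα1)]
  have hp := hre z hz
  have hAz := hA z hz
  rw [norm_div, div_le_iff₀ (norm_pos_iff.2 (hne _ hp))] at hom
  set A := 1 + z * deriv h z / h z with hAdef
  set B := z * deriv g z / g z with hBdef
  have hp0 : A - B ≠ 0 := by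
    intro h0; rw [h0] at hp; simp at hp; linarith
  obtain ⟨h1, h2⟩ := aux_p (A - B) α ‖z‖ hα0 hα1 (norm_nonneg _) hzn hp hom
  have h3 := aux_q _ _ hmu hzn
  have e1 : z / (A - B) / z = 1 / (A - B) := by field_simp
  refine ⟨z / (A - B), ?_, ?_, ?_⟩
  · rw [e1]; exact h1
  · rw [e1]; exact h2
  · rw [← Complex.add_re, e1]
    convert h3 using 2
    have hhz := hhne z hz
    have e2 : deriv h z * (z / (A - B)) / h z = (A - 1) / (A - B) := by
      rw [hAdef]; field_simp; ring
    rw [e2]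
    have : 1 - B / A = (A - B) / A := by field_simp
    rw [this]
    field_simp
    ring

lemma aux_line (z v : ℂ) : HasDerivAt (fun t : ℝ => z - t * v) (-v) 0 := by
  have h1 : HasDerivAt (fun t : ℝ => (t : ℂ)) 1 0 := Complex.ofRealCLM.hasDerivAt
  simpa using! (h1.mul_const v).const_sub z

lemma aux_lineh (h : ℂ → ℂ) (z v : ℂ) (hd : DifferentiableAt ℂ h z) :
    HasDerivAt (fun t : ℝ => h (z - t * v)) (-(deriv h z * v)) 0 := by
  have h1 := aux_line z v
  have h2 : HasDerivAt h (deriv h z) (z - ((0:ℝ):ℂ) * v) := by simpa using hd.hasDerivAt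
  have := h2.comp (0:ℝ) h1
  simpa using! this

lemma aux_move (h : ℂ → ℂ) (z v : ℂ) (hz0 : z ≠ 0) (hd : DifferentiableAt ℂ h z)
    (hh : h z ≠ 0) (h1 : 0 < (v / z).re) (h2 : 0 < (v / z).re + (deriv h z * v / h z).re) :
    ∃ᶠ w in 𝓝 z, ‖w‖ < ‖z‖ ∧ ‖w * h w‖ < ‖z * h z‖ := by
  have hl := aux_line z v
  have hlh := aux_lineh h z v hd
  have a1 := aux_log hl (by simpa using hz0)
  have a2 := aux_log hlh (by simpa using hh)
  have b1 := aux_desc a1 (by simp [neg_div]; exact h1)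
  have b2 := aux_desc (a1.add a2) (by simp [neg_div]; linarith)
  have c1 : ∀ᶠ t : ℝ in 𝓝[>] (0:ℝ), z - (t:ℂ) * v ≠ 0 :=
    (hl.continuousAt.eventually_ne (by simpa using hz0)).filter_mono nhdsWithin_le_nhds
  have c2 : ∀ᶠ t : ℝ in 𝓝[>] (0:ℝ), h (z - (t:ℂ) * v) ≠ 0 :=
    (hlh.continuousAt.eventually_ne (by simpa using hh)).filter_mono nhdsWithin_le_nhds
  have hT : Tendsto (fun t : ℝ => z - (t:ℂ) * v) (𝓝[>] 0) (𝓝 z) := by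
    have := hl.continuousAt.tendsto
    simp only [Complex.ofReal_zero, zero_mul, sub_zero] at this
    exact this.mono_left nhdsWithin_le_nhds
  refine hT.frequently (Eventually.frequently ?_)
  filter_upwards [b1, b2, c1, c2] with t t1 t2 t3 t4
  simp only [Complex.ofReal_zero, zero_mul, sub_zero, Pi.add_apply, Pi.div_apply] at t1 t2
  have n3 := norm_pos_iff.2 t3
  have n4 := norm_pos_iff.2 t4
  have nz := norm_pos_iff.2 hz0
  have nh := norm_pos_iff.2 hh
  refine ⟨(Real.log_lt_log_iff n3 nz).1 t1, ?_⟩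
  rw [norm_mul, norm_mul]
  rw [← Real.log_mul n3.ne' n4.ne', ← Real.log_mul nz.ne' nh.ne'] at t2
  exact (Real.log_lt_log_iff (by positivity) (by positivity)).1 t2

lemma aux_lower0 (α : ℝ) (hα1 : α < 1) (h : ℂ → ℂ)
    (hh : DifferentiableOn ℂ h (ball 0 1)) (hh0 : h 0 = 1)
    (hhne : ∀ z ∈ ball (0:ℂ) 1, h z ≠ 0)
    (hdir : ∀ z ∈ ball (0:ℂ) 1, z ≠ 0 → ∃ v : ℂ, 0 < (v / z).re ∧
      (v / z).re * (1 - (1 - 2 * α) * ‖z‖) ≤ 1 + ‖z‖ ∧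
      1 / (1 + ‖z‖) ≤ (v / z).re + (deriv h z * v / h z).re)
    (ε : ℝ) (hε : 0 < ε) (z0 : ℂ) (hz0 : z0 ∈ ball (0:ℂ) 1) :
    0 ≤ Real.log ‖h z0‖ +
      (Real.log (1 + ‖z0‖) + 2 * (1 - α) * (‖z0‖ / (1 + ‖z0‖)) + ε * ‖z0‖) := by
  by_contra hcon
  push Not at hcon
  set u : ℂ → ℝ := fun z => Real.log ‖h z‖ +
      (Real.log (1 + ‖z‖) + 2 * (1 - α) * (‖z‖ / (1 + ‖z‖)) + ε * ‖z‖) with hu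
  have hz0n : ‖z0‖ < 1 := by simpa using hz0
  have hsub : closedBall (0:ℂ) ‖z0‖ ⊆ ball 0 1 := closedBall_subset_ball hz0n
  have hcont : ContinuousOn u (closedBall 0 ‖z0‖) := by
    refine ContinuousOn.add ?_ ?_
    · exact (hh.continuousOn.mono hsub).norm.log fun z hz => norm_ne_zero_iff.2 (hhne z (hsub hz))
    · have hp : ∀ z : ℂ, 1 + ‖z‖ ≠ 0 := fun z => by positivity
      refine Continuous.continuousOn ?_
      have c1 : Continuous fun z : ℂ => 1 + ‖z‖ := by fun_prop
      exact ((c1.log hp).add ((continuous_norm.div c1 hp).const_mul _)).add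
        (continuous_norm.const_mul _)
  obtain ⟨z, hzm, hmin⟩ := (isCompact_closedBall (0:ℂ) ‖z0‖).exists_isMinOn
    ⟨z0, by simp⟩ hcont
  have hz0min : u z ≤ u z0 := hmin (by simp : z0 ∈ closedBall (0:ℂ) ‖z0‖)
  have hneg : u z < 0 := lt_of_le_of_lt hz0min hcon
  have hzne : z ≠ 0 := by
    rintro rfl
    simp [hu, hh0] at hneg
  have hzb := hsub hzm
  obtain ⟨v, h1, h2, h3⟩ := hdir z hzb hzne
  have hl := aux_line z v
  have hhz := hhne z hzb
  have hlh := aux_lineh h z v (hh.differentiableAt (isOpen_ball.mem_nhds hzb))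
  have a1 := aux_norm hl (by simpa using hzne)
  have a2 := aux_log hlh (by simpa using hhz)
  have r0 : 0 < ‖z‖ := norm_pos_iff.2 hzne
  have hne : 1 + ‖z - ((0:ℝ):ℂ) * v‖ ≠ 0 := by positivity
  have a3 := (a1.const_add 1)
  have a4 := a2.add (((a3.log hne).add ((a1.div a3 hne).const_mul (2 * (1 - α)))).add
    (a1.const_mul ε))
  have b1 := aux_desc a1 (by simp [neg_div]; exact mul_pos r0 h1)
  have b2 := aux_desc a4 (by
    simp only [Complex.ofReal_zero, zero_mul, sub_zero, neg_div, Complex.neg_re]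
    set Q := (v / z).re
    set r := ‖z‖
    set S := (deriv h z * v / h z).re
    have e : -S + (r * -Q / (1 + r) + 2 * (1 - α) * ((r * -Q * (1 + r) - r * (r * -Q)) / (1 + r) ^ 2)
        + ε * (r * -Q)) = -(Q + S) + Q * (1 - (1 - 2 * α) * r) / (1 + r) ^ 2 - ε * (r * Q) := by
      field_simp
      ring
    rw [e]
    have f1 : Q * (1 - (1 - 2 * α) * r) / (1 + r) ^ 2 ≤ 1 / (1 + r) := by
      rw [div_le_div_iff₀ (by positivity) (by positivity)]
      nlinarith
    have f2 : 0 < ε * (r * Q) := by positivity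
    linarith)
  obtain ⟨t, t1, t2⟩ := (b1.and b2).exists
  simp only [Complex.ofReal_zero, zero_mul, sub_zero, Pi.add_apply, Pi.div_apply] at t1 t2
  have hmem : z - (t:ℂ) * v ∈ closedBall (0:ℂ) ‖z0‖ := by
    rw [mem_closedBall_zero_iff] at hzm ⊢
    linarith
  have := hmin hmem
  have h5 : u z ≤ u (z - (t:ℂ) * v) := this
  exact absurd h5 (not_le.2 t2)

lemma aux_lower (α : ℝ) (hα1 : α < 1) (h : ℂ → ℂ)
    (hh : DifferentiableOn ℂ h (ball 0 1)) (hh0 : h 0 = 1)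
    (hhne : ∀ z ∈ ball (0:ℂ) 1, h z ≠ 0)
    (hdir : ∀ z ∈ ball (0:ℂ) 1, z ≠ 0 → ∃ v : ℂ, 0 < (v / z).re ∧
      (v / z).re * (1 - (1 - 2 * α) * ‖z‖) ≤ 1 + ‖z‖ ∧
      1 / (1 + ‖z‖) ≤ (v / z).re + (deriv h z * v / h z).re)
    (z : ℂ) (hz : z ∈ ball (0:ℂ) 1) :
    ‖z‖ * (1 / (2 * Real.exp (1 - α))) ≤ ‖z * h z‖ := by
  have hzn : ‖z‖ < 1 := by simpa using hz
  have r0 := norm_nonneg z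
  have hhz := norm_pos_iff.2 (hhne z hz)
  have h1 : 0 ≤ Real.log ‖h z‖ +
      (Real.log (1 + ‖z‖) + 2 * (1 - α) * (‖z‖ / (1 + ‖z‖))) := by
    refine le_of_forall_pos_le_add fun ε hε => ?_
    have := aux_lower0 α hα1 h hh hh0 hhne hdir ε hε z hz
    nlinarith
  have h2 : Real.log (1 + ‖z‖) ≤ Real.log 2 := Real.log_le_log (by positivity) (by linarith)
  have h3 : ‖z‖ / (1 + ‖z‖) ≤ 1 / 2 := by
    rw [div_le_div_iff₀ (by positivity) (by positivity)]; linarith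
  have h4 : -Real.log (2 * Real.exp (1 - α)) ≤ Real.log ‖h z‖ := by
    rw [Real.log_mul (by norm_num) (Real.exp_pos _).ne', Real.log_exp]
    nlinarith
  rw [← Real.log_inv] at h4
  rw [norm_mul, one_div]
  exact mul_le_mul_of_nonneg_left ((Real.log_le_log_iff (by positivity) hhz).1 h4) r0

lemma aux_mono (H : ℂ → ℂ) (hH : ContinuousOn H (ball 0 1))
    (hmv : ∀ z ∈ ball (0:ℂ) 1, z ≠ 0 → ∃ᶠ w in 𝓝 z, ‖w‖ < ‖z‖ ∧ ‖H w‖ < ‖H z‖)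
    (r m : ℝ) (hr : 0 < r) (hm : ∀ w : ℂ, ‖w‖ = r → m ≤ ‖H w‖)
    (z : ℂ) (hrz : r < ‖z‖) (hz : ‖z‖ < 1) : m < ‖H z‖ := by
  have hstep : ∀ y : ℂ, r < ‖y‖ → ‖y‖ < 1 → ∃ w : ℂ, r < ‖w‖ ∧ ‖w‖ < ‖y‖ ∧ ‖H w‖ < ‖H y‖ := by
    intro y hy hy1
    have h1 := hmv y (by simpa using hy1) (norm_pos_iff.1 (hr.trans hy))
    have h2 : ∀ᶠ w in 𝓝 y, r < ‖w‖ := continuous_norm.continuousAt.eventually (lt_mem_nhds hy)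
    obtain ⟨w, hw, hw'⟩ := (h1.and_eventually h2).exists
    exact ⟨w, hw', hw⟩
  obtain ⟨w, w1, w2, w3⟩ := hstep z hrz hz
  have hK : IsCompact (closedBall (0:ℂ) ‖z‖ ∩ {w | r ≤ ‖w‖}) :=
    (isCompact_closedBall _ _).inter_right (isClosed_le continuous_const continuous_norm)
  have hcont : ContinuousOn (fun w => ‖H w‖) (closedBall (0:ℂ) ‖z‖ ∩ {w | r ≤ ‖w‖}) :=
    (hH.mono (inter_subset_left.trans (closedBall_subset_ball hz))).norm
  obtain ⟨y, ⟨hy1, hy2⟩, hmin⟩ := hK.exists_isMinOn ⟨w, by simpa using w2.le, w1.le⟩ hcont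
  have hy1' : ‖y‖ ≤ ‖z‖ := by simpa using hy1
  have hy2' : r ≤ ‖y‖ := hy2
  have hyr : ‖y‖ = r := by
    by_contra hne
    obtain ⟨x, x1, x2, x3⟩ := hstep y (lt_of_le_of_ne hy2' (Ne.symm hne)) (by linarith)
    have hx : ‖H y‖ ≤ ‖H x‖ := hmin ⟨by simpa using (by linarith : ‖x‖ ≤ ‖z‖), x1.le⟩
    linarith
  have hyw : ‖H y‖ ≤ ‖H w‖ := hmin ⟨by simpa using w2.le, w1.le⟩
  have := hm y hyr
  linarith

lemma aux_le_one (h : ℂ → ℂ) (hh : DifferentiableOn ℂ h (ball 0 1)) (hh0 : h 0 = 1)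
    (hhne : ∀ z ∈ ball (0:ℂ) 1, h z ≠ 0) (r m : ℝ) (hr : 0 < r) (hr1 : r < 1)
    (hm : ∀ w : ℂ, ‖w‖ = r → m ≤ ‖w * h w‖) : m ≤ 1 := by
  by_contra hcon
  push Not at hcon
  have hsub : closedBall (0:ℂ) r ⊆ ball 0 1 := closedBall_subset_ball hr1
  have hd : DifferentiableOn ℂ (fun z => (h z)⁻¹) (ball 0 1) := hh.inv hhne
  have hdc : DiffContOnCl ℂ (fun z => (h z)⁻¹) (ball 0 r) :=
    (hd.mono (by rw [closure_ball _ hr.ne']; exact hsub)).diffContOnCl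
  have := Complex.norm_le_of_forall_mem_frontier_norm_le isBounded_ball hdc (C := r) (z := 0) (by
    intro w hw
    rw [frontier_ball _ hr.ne', mem_sphere_zero_iff_norm] at hw
    have h1 := hm w hw
    have h2 := norm_pos_iff.2 (hhne w (by simpa [hw] using hr1))
    rw [norm_mul, hw] at h1
    rw [norm_inv, inv_le_iff_one_le_mul₀ h2]
    linarith) (subset_closure (by simpa using hr))
  simp [hh0] at this
  linarith

lemma aux_inj (H : ℂ → ℂ) (hH : DifferentiableOn ℂ H (ball 0 1))
    (hd : ∀ z ∈ ball (0:ℂ) 1, deriv H z ≠ 0) (hzero : ∀ z ∈ ball (0:ℂ) 1, H z = 0 → z = 0)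
    (r m : ℝ) (hr1 : r < 1)
    (hm : ∀ z ∈ ball (0:ℂ) 1, r ≤ ‖z‖ → m ≤ ‖H z‖)
    (a b : ℂ) (ha : a ∈ ball (0:ℂ) 1) (hb : b ∈ ball (0:ℂ) 1) (hab : H a = H b)
    (ham : ‖H a‖ < m) : a = b := by
  by_contra hne
  have hstrict : ∀ z ∈ ball (0:ℂ) 1, HasStrictDerivAt H (deriv H z) z := fun z hz =>
    (hH.analyticAt (isOpen_ball.mem_nhds hz)).hasStrictDerivAt
  have hsub : closedBall (0:ℂ) r ⊆ ball 0 1 := closedBall_subset_ball hr1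
  have hin : ∀ z ∈ ball (0:ℂ) 1, ‖H z‖ < m → z ∈ closedBall (0:ℂ) r := by
    intro z hz hzm
    rw [mem_closedBall_zero_iff]
    by_contra hc
    exact absurd (hm z hz (not_le.1 hc).le) (not_le.2 hzm)
  have hloc : ∀ z ∈ ball (0:ℂ) 1, ∃ U : Set ℂ, IsOpen U ∧ z ∈ U ∧ InjOn H U := by
    intro z hz
    have h1 := (hstrict z hz).eventually_left_inverse (hd z hz)
    obtain ⟨U, hU, hUo, hzU⟩ := _root_.eventually_nhds_iff.1 h1
    refine ⟨U, hUo, hzU, fun x hx y hy hxy => ?_⟩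
    rw [← hU x hx, ← hU y hy, hxy]
  choose! U hUo hzU hUi using hloc
  set O : Set (ℂ × ℂ) := ⋃ z ∈ ball (0:ℂ) 1, U z ×ˢ U z with hO
  have hOo : IsOpen O := isOpen_biUnion fun z hz => (hUo z hz).prod (hUo z hz)
  set B := closedBall (0:ℂ) r with hB
  have hc1 : ContinuousOn (fun q : ℂ × ℂ => H q.1) (B ×ˢ B) :=
    (hH.continuousOn.mono hsub).comp continuous_fst.continuousOn fun q hq => hq.1
  have hc2 : ContinuousOn (fun q : ℂ × ℂ => H q.2) (B ×ˢ B) :=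
    (hH.continuousOn.mono hsub).comp continuous_snd.continuousOn fun q hq => hq.2
  have hBc : IsCompact (B ×ˢ B) := (isCompact_closedBall _ _).prod (isCompact_closedBall _ _)
  have hK1 : IsCompact ((B ×ˢ B) ∩ (fun q : ℂ × ℂ => H q.1 - H q.2) ⁻¹' {0}) :=
    hBc.of_isClosed_subset
      ((hc1.sub hc2).preimage_isClosed_of_isClosed hBc.isClosed isClosed_singleton) inter_subset_left
  have hK : IsCompact (((B ×ˢ B) ∩ (fun q : ℂ × ℂ => H q.1 - H q.2) ⁻¹' {0}) \ O) :=
    hK1.diff hOo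
  have hnotO : ∀ x y : ℂ, x ≠ y → H x = H y → (x, y) ∉ O := by
    intro x y hxy hH' hmem
    rw [hO] at hmem
    simp only [mem_iUnion, mem_prod] at hmem
    obtain ⟨z, hz, h1, h2⟩ := hmem
    exact hxy (hUi z hz h1 h2 hH')
  have habK : (a, b) ∈ ((B ×ˢ B) ∩ (fun q : ℂ × ℂ => H q.1 - H q.2) ⁻¹' {0}) \ O :=
    ⟨⟨⟨hin a ha ham, hin b hb (hab ▸ ham)⟩, by simp [hab]⟩, hnotO a b hne hab⟩
  obtain ⟨⟨x, y⟩, ⟨⟨⟨hx, hy⟩, hxy⟩, hxyO⟩, hmin⟩ := hK.exists_isMinOn ⟨_, habK⟩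
    (hc1.norm.mono (sdiff_subset.trans inter_subset_left))
  have hxb := hsub hx
  have hyb := hsub hy
  simp only at hxb hyb
  have hxy' : H x = H y := by simpa [sub_eq_zero] using hxy
  have hxne : x ≠ y := by
    rintro rfl
    refine hxyO ?_
    rw [hO]
    simp only [mem_iUnion, mem_prod]
    exact ⟨x, hxb, hzU x hxb, hzU x hxb⟩
  have hxm : ‖H x‖ < m := lt_of_le_of_lt (hmin habK) ham
  have hHx : H x ≠ 0 := fun h0 => hxne (by
    rw [hzero x hxb h0, hzero y hyb (hxy' ▸ h0)])
  obtain ⟨V, W, hV, hW, hxV, hyW, hVW⟩ := t2_separation hxne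
  have mx := (hstrict x hxb).map_nhds_eq (hd x hxb)
  have my := (hstrict y hyb).map_nhds_eq (hd y hyb)
  have nx : H '' (V ∩ ball 0 1) ∈ 𝓝 (H x) := by
    rw [← mx]; exact image_mem_map (inter_mem (hV.mem_nhds hxV) (isOpen_ball.mem_nhds hxb))
  have ny : H '' (W ∩ ball 0 1) ∈ 𝓝 (H x) := by
    rw [hxy', ← my]; exact image_mem_map (inter_mem (hW.mem_nhds hyW) (isOpen_ball.mem_nhds hyb))
  have hT : Tendsto (fun t : ℝ => ((1 - t : ℝ) : ℂ) * H x) (𝓝[>] 0) (𝓝 (H x)) := by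
    have : Continuous (fun t : ℝ => ((1 - t : ℝ) : ℂ) * H x) := by fun_prop
    have := this.tendsto 0
    simp only [sub_zero, Complex.ofReal_one, one_mul] at this
    exact this.mono_left nhdsWithin_le_nhds
  have hlt : ∀ᶠ t : ℝ in 𝓝[>] 0, t < 1 := nhdsWithin_le_nhds (gt_mem_nhds one_pos)
  obtain ⟨t, ⟨⟨⟨x', hx', ex⟩, ⟨y', hy', ey⟩⟩, ht1⟩, ht0⟩ :=
    (((hT.eventually (inter_mem nx ny)).and hlt).and self_mem_nhdsWithin).exists
  have ht0' : 0 < t := ht0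
  have hlt' : ‖H x'‖ < ‖H x‖ := by
    rw [ex, norm_mul, Complex.norm_real, Real.norm_eq_abs, abs_of_pos (by linarith)]
    have := norm_pos_iff.2 hHx
    nlinarith
  have hxy2 : H x' = H y' := by rw [ex, ey]
  have hne' : x' ≠ y' := fun h => (Set.disjoint_left.1 hVW hx'.1) (h ▸ hy'.1)
  have hmem : (x', y') ∈ ((B ×ˢ B) ∩ (fun q : ℂ × ℂ => H q.1 - H q.2) ⁻¹' {0}) \ O :=
    ⟨⟨⟨hin x' hx'.2 (hlt'.trans hxm), hin y' hy'.2 (hxy2 ▸ hlt'.trans hxm)⟩, by simp [hxy2]⟩,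
      hnotO x' y' hne' hxy2⟩
  have : ‖H x‖ ≤ ‖H x'‖ := hmin hmem
  linarith

lemma aux_open (H : ℂ → ℂ) (hH : DifferentiableOn ℂ H (ball 0 1))
    (hd : ∀ z ∈ ball (0:ℂ) 1, deriv H z ≠ 0) (r : ℝ) (hr : r ≤ 1) : IsOpen (H '' ball 0 r) := by
  rw [isOpen_iff_mem_nhds]
  rintro _ ⟨z, hz, rfl⟩
  have hz1 := ball_subset_ball hr hz
  have hs := (hH.analyticAt (isOpen_ball.mem_nhds hz1)).hasStrictDerivAt
  rw [← hs.map_nhds_eq (hd z hz1)]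
  exact image_mem_map (isOpen_ball.mem_nhds hz)

lemma aux_uncov (H : ℂ → ℂ) (hH : DifferentiableOn ℂ H (ball 0 1))
    (hd : ∀ z ∈ ball (0:ℂ) 1, deriv H z ≠ 0) (hzero : ∀ z ∈ ball (0:ℂ) 1, H z = 0 → z = 0)
    (hmv : ∀ z ∈ ball (0:ℂ) 1, z ≠ 0 → ∃ᶠ w in 𝓝 z, ‖w‖ < ‖z‖ ∧ ‖H w‖ < ‖H z‖)
    (hone : ∀ r m : ℝ, 0 < r → r < 1 → (∀ w : ℂ, ‖w‖ = r → m ≤ ‖H w‖) → m ≤ 1) :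
    ¬ (closedBall (0:ℂ) 1 ⊆ H '' ball 0 1) := by
  intro hcov
  set T : Set ℝ := {m | ∃ r, 0 < r ∧ r < 1 ∧ ∀ w : ℂ, ‖w‖ = r → m ≤ ‖H w‖} with hT
  have hT1 : ∀ m ∈ T, m ≤ 1 := by
    rintro m ⟨r, h0, h1, h2⟩
    exact hone r m h0 h1 h2
  have hTne : (0:ℝ) ∈ T := ⟨1/2, by norm_num, by norm_num, fun w _ => norm_nonneg _⟩
  have hbdd : BddAbove T := ⟨1, hT1⟩
  set M := sSup T with hM
  have hM1 : M ≤ 1 := csSup_le ⟨0, hTne⟩ hT1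
  -- injectivity below M
  have hinj : ∀ a ∈ ball (0:ℂ) 1, ∀ b ∈ ball (0:ℂ) 1, H a = H b → ‖H a‖ < M → a = b := by
    intro a ha b hb hab ham
    obtain ⟨m, ⟨r, h0, h1, h2⟩, hm⟩ := exists_lt_of_lt_csSup ⟨0, hTne⟩ ham
    refine aux_inj H hH hd hzero r m h1 ?_ a b ha hb hab hm
    intro z hz hrz
    rcases hrz.eq_or_lt with he | hlt
    · exact h2 z he.symm
    · exact (aux_mono H hH.continuousOn hmv r m h0 h2 z hlt (by simpa using hz)).le
  -- compactness
  obtain ⟨⟨r, hr0, hr1⟩, hr⟩ : ∃ r : {r : ℝ // 0 < r ∧ r < 1},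
      closedBall (0:ℂ) M ⊆ H '' ball 0 (r : ℝ) := by
    haveI : Nonempty {r : ℝ // 0 < r ∧ r < 1} := ⟨⟨1/2, by norm_num, by norm_num⟩⟩
    refine (isCompact_closedBall (0:ℂ) M).elim_directed_cover
      (fun r : {r : ℝ // 0 < r ∧ r < 1} => H '' ball 0 (r : ℝ))
      (fun r => aux_open H hH hd r r.2.2.le) ?_ ?_
    · intro c hc
      obtain ⟨z, hz, rfl⟩ := hcov (closedBall_subset_closedBall hM1 hc)
      have hz1 : ‖z‖ < 1 := by simpa using hz
      have := norm_nonneg z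
      refine mem_iUnion.2 ⟨⟨(1 + ‖z‖) / 2, by linarith, by linarith⟩, z, ?_, rfl⟩
      simp only [mem_ball_zero_iff]
      linarith
    · intro r s
      rcases le_total (r : ℝ) s with hle | hle
      · exact ⟨s, image_mono (ball_subset_ball hle), subset_rfl⟩
      · exact ⟨r, subset_rfl, image_mono (ball_subset_ball hle)⟩
  simp only at hr
  have hge : ∀ z : ℂ, ‖z‖ = r → M ≤ ‖H z‖ := by
    intro z hzr
    by_contra hc
    push Not at hc
    obtain ⟨y, hy, hyz⟩ := hr (by simpa using hc.le : H z ∈ closedBall (0:ℂ) M)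
    have hzb : z ∈ ball (0:ℂ) 1 := by simpa [hzr] using hr1
    have := hinj z hzb y (ball_subset_ball hr1.le hy) hyz.symm hc
    rw [← this, mem_ball_zero_iff] at hy
    linarith
  -- strict growth
  set s := (1 + r) / 2 with hs
  have hs1 : s < 1 := by linarith
  have hrs : r < s := by linarith
  have hss : sphere (0:ℂ) s ⊆ ball 0 1 := sphere_subset_closedBall.trans (closedBall_subset_ball hs1)
  obtain ⟨y, hy, hmin⟩ := (isCompact_sphere (0:ℂ) s).exists_isMinOn
    (NormedSpace.sphere_nonempty.2 (by linarith)) (hH.continuousOn.mono hss).norm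
  have hys : ‖y‖ = s := by simpa using hy
  have hMy := aux_mono H hH.continuousOn hmv r M hr0 hge y (by linarith) (by linarith)
  have : ‖H y‖ ∈ T := ⟨s, by linarith, hs1, fun w hw => hmin (by simpa using hw)⟩
  have := le_csSup hbdd this
  linarith

theorem stmt_2 (α : ℝ) (hα0 : 0 ≤ α) (hα1 : α < 1)
    (h g : ℂ → ℂ)
    (hh : DifferentiableOn ℂ h (ball 0 1))
    (hg : DifferentiableOn ℂ g (ball 0 1))
    (hh0 : h 0 = 1) (hg0 : g 0 = 1)
    (hhne : ∀ z ∈ ball (0:ℂ) 1, h z ≠ 0)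
    (hgne : ∀ z ∈ ball (0:ℂ) 1, g z ≠ 0)
    (hsp : ∀ z ∈ ball (0:ℂ) 1,
      ‖z * deriv g z / g z‖ < ‖1 + z * deriv h z / h z‖)
    (hinj : Set.InjOn (fun z => z * h z * (starRingEnd ℂ) (g z)) (ball 0 1))
    (hstar : ∀ z ∈ ball (0:ℂ) 1, z ≠ 0 →
      α < (1 + z * deriv h z / h z - (starRingEnd ℂ) (z * deriv g z / g z)).re) :
    1 / (2 * Real.exp (1 - α)) ≤
        infDist 0 (frontier ((fun z => z * h z) '' ball 0 1)) ∧
      infDist 0 (frontier ((fun z => z * h z) '' ball 0 1)) ≤ 1 := by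
  have hdir := aux_dir α hα0 hα1 h g hh hg hhne hgne hsp hstar
  have hlow := aux_lower α hα1 h hh hh0 hhne hdir
  set H : ℂ → ℂ := fun z => z * h z with hHdef
  have hH : DifferentiableOn ℂ H (ball 0 1) := differentiableOn_id.mul hh
  have hd : ∀ z ∈ ball (0:ℂ) 1, deriv H z ≠ 0 := by
    intro z hz h0
    have h1 : HasDerivAt H (1 * h z + z * deriv h z) z :=
      (hasDerivAt_id z).mul (hh.differentiableAt (isOpen_ball.mem_nhds hz)).hasDerivAt
    rw [h1.deriv] at h0
    have h2 : 1 + z * deriv h z / h z = 0 := by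
      have := hhne z hz
      field_simp
      linear_combination h0
    have h3 := hsp z hz
    rw [h2, norm_zero] at h3
    exact absurd h3 (not_lt.2 (norm_nonneg _))
  have hzero : ∀ z ∈ ball (0:ℂ) 1, H z = 0 → z = 0 := by
    intro z hz h0
    exact (mul_eq_zero.1 h0).resolve_right (hhne z hz)
  have hmv : ∀ z ∈ ball (0:ℂ) 1, z ≠ 0 → ∃ᶠ w in 𝓝 z, ‖w‖ < ‖z‖ ∧ ‖H w‖ < ‖H z‖ := by
    intro z hz hz0
    obtain ⟨v, h1, _, h3⟩ := hdir z hz hz0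
    have : 0 < 1 / (1 + ‖z‖) := by positivity
    exact aux_move h z v hz0 (hh.differentiableAt (isOpen_ball.mem_nhds hz)) (hhne z hz) h1
      (by linarith)
  have hunc := aux_uncov H hH hd hzero hmv
    (fun r m h0 h1 h2 => aux_le_one h hh hh0 hhne r m h0 h1 h2)
  have hopen := aux_open H hH hd 1 le_rfl
  set Ω := H '' ball 0 1 with hΩ
  have h0Ω : (0:ℂ) ∈ Ω := ⟨0, by simp, by simp [hHdef]⟩
  obtain ⟨c, hcf, hc1⟩ : ∃ c ∈ frontier Ω, ‖c‖ ≤ 1 := by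
    by_contra hcon
    push Not at hcon
    refine hunc ?_
    have hpre : IsPreconnected (closedBall (0:ℂ) 1) := (convex_closedBall 0 1).isPreconnected
    refine hpre.subset_left_of_subset_union hopen isClosed_closure.isOpen_compl
      (Set.disjoint_left.2 fun x hx hx' => hx' (subset_closure hx)) ?_ ⟨0, by simp, h0Ω⟩
    intro x hx
    by_cases hxc : x ∈ closure Ω
    · left
      by_contra hxo
      have : x ∈ frontier Ω := by
        rw [hopen.frontier_eq]; exact ⟨hxc, hxo⟩
      have h1 := hcon x this
      rw [mem_closedBall_zero_iff] at hx
      linarith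
    · exact Or.inr hxc
  refine ⟨?_, (infDist_le_dist_of_mem hcf).trans (by simpa using hc1)⟩
  rw [le_infDist ⟨c, hcf⟩]
  intro w hw
  rw [dist_zero_left]
  rw [hopen.frontier_eq] at hw
  obtain ⟨hwc, hwo⟩ := hw
  set l := 1 / (2 * Real.exp (1 - α)) with hl
  have hl0 : 0 < l := by positivity
  have hr : ∀ r : ℝ, 0 < r → r < 1 → r * l ≤ ‖w‖ := by
    intro r hr0 hr1
    have hsplit : Ω ⊆ H '' closedBall 0 r ∪ {c | r * l ≤ ‖c‖} := by
      rintro _ ⟨z, hz, rfl⟩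
      rcases le_total ‖z‖ r with hle | hle
      · exact Or.inl ⟨z, by simpa using hle, rfl⟩
      · exact Or.inr ((mul_le_mul_of_nonneg_right hle hl0.le).trans (hlow z hz))
    have hsub := closedBall_subset_ball (x := (0:ℂ)) hr1
    have hcl : IsClosed (H '' closedBall 0 r ∪ {c | r * l ≤ ‖c‖}) :=
      ((isCompact_closedBall (0:ℂ) r).image_of_continuousOn
        (hH.continuousOn.mono hsub)).isClosed.union
        (isClosed_le continuous_const continuous_norm)
    rcases closure_minimal hsplit hcl hwc with h1 | h1
    · exact absurd (image_mono hsub h1) hwo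
    · exact h1
  by_contra hcon
  push Not at hcon
  have hw0 := norm_nonneg w
  have hq : ‖w‖ / l < 1 := (div_lt_one hl0).2 hcon
  have hq0 : 0 ≤ ‖w‖ / l := by positivity
  have := hr ((1 + ‖w‖ / l) / 2) (by linarith) (by linarith)
  rw [← le_div_iff₀ hl0] at this
  linarith
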